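/- Let G be a finite simple graph with maximum degree at most 3, let S be a set of vertices of G admitting a vertically extensible partial drawing, and let v be a vertex not in S all three of whose neighbors lie in S. Then there exists a vertically extensible partial drawing of S ∪ {v}. -/

import Mathlib

open InnerProductGeometry

noncomputable section

/-- Points of three-dimensional Euclidean space. -/
abbrev Pt : Type := EuclideanSpace ℝ (Fin 3)

/-- The image of a polyline given by a list of points: the union of the closed
segments between consecutive points. -/
def polyImage (l : List Pt) : Set Pt :=
  ⋃ q ∈ l.zip l.tail, segment ℝ q.1 q.2

/-- A polyline is simple (its image is a simple arc): consecutive points are distinct,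
two consecutive segments meet exactly in their shared endpoint, and two
non-consecutive segments are disjoint. -/
def SimplePolyline (l : List Pt) : Prop :=
  l.Chain' (· ≠ ·) ∧
  ∀ i j : ℕ, ∀ hi : i + 1 < l.length, ∀ hj : j + 1 < l.length, i < j →
    segment ℝ (l.get ⟨i, by omega⟩) (l.get ⟨i + 1, hi⟩) ∩
      segment ℝ (l.get ⟨j, by omega⟩) (l.get ⟨j + 1, hj⟩) =
      if j = i + 1 then {l.get ⟨j, by omega⟩} else ∅

/-- A polyline drawing of a (finite simple) graph `G` in ℝ³: an injective placement
`p` of the vertices, and for each (oriented) edge `uv` a list of points, starting at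
`p u` and ending at `p v`, giving the polygonal path of the edge; the path of `vu`
is the reverse of the path of `uv`.  The interior points of the list are the bends
of the edge. -/
structure PolylineDrawing {V : Type*} (G : SimpleGraph V) where
  p : V → Pt
  p_inj : Function.Injective p
  seq : ∀ u v : V, G.Adj u v → List Pt
  seq_head : ∀ u v h, (seq u v h).head? = some (p u)
  seq_last : ∀ u v h, (seq u v h).getLast? = some (p v)
  seq_symm : ∀ u v h, seq v u h.symm = (seq u v h).reverse

variable {V : Type*} {G : SimpleGraph V}

/-- Every edge is drawn with at most `k` bends, i.e. its point list has at most
`k + 2` points. -/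
def MaxBends (D : PolylineDrawing G) (k : ℕ) : Prop :=
  ∀ u v h, (D.seq u v h).length ≤ k + 2

/-- The image of the whole drawing: all vertex points and all edge paths. -/
def drawingImage (D : PolylineDrawing G) : Set Pt :=
  Set.range D.p ∪ ⋃ (u) (v) (h : G.Adj u v), polyImage (D.seq u v h)

/-- The drawing has angular resolution at least `θ`: the angle at every bend of every
edge, and the angle at a common vertex between the initial segments of any two
distinct edges, is at least `θ`. -/
def AngularResAtLeast (D : PolylineDrawing G) (θ : ℝ) : Prop :=
  (∀ u v h, ∀ a q b : Pt, [a, q, b] <:+: D.seq u v h →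
    θ ≤ angle (a - q) (b - q)) ∧
  (∀ v u w : V, ∀ hu : G.Adj v u, ∀ hw : G.Adj v w, u ≠ w →
    ∀ a b : Pt, (D.seq v u hu)[1]? = some a → (D.seq v w hw)[1]? = some b →
      θ ≤ angle (a - D.p v) (b - D.p v))

/-- The drawing is non-crossing: every edge path is a simple arc meeting the vertex
points only in its endpoints, and the paths of two distinct edges intersect exactly
in the images of their common endpoints. -/
def NonCrossing (D : PolylineDrawing G) : Prop :=
  (∀ u v h, SimplePolyline (D.seq u v h)) ∧
  (∀ u v h, polyImage (D.seq u v h) ∩ Set.range D.p = {D.p u, D.p v}) ∧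
  (∀ u v u' v' : V, ∀ h : G.Adj u v, ∀ h' : G.Adj u' v', s(u, v) ≠ s(u', v') →
    polyImage (D.seq u v h) ∩ polyImage (D.seq u' v' h') =
      D.p '' (({u, v} : Set V) ∩ {u', v'}))

/-- The unit vector in the positive `z`-direction. -/
def zDir : Pt := EuclideanSpace.single 2 1

/-- The open ray from `q` in the positive `z`-direction. -/
def zRay (q : Pt) : Set Pt := {x : Pt | ∃ t : ℝ, 0 < t ∧ x = q + t • zDir}

/-- `D` is a vertically extensible partial drawing of the vertex set `S` of `G`:
a non-crossing drawing of the induced subgraph `G[S]` with angular resolution at least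
`2π/3` and at most two bends per edge, such that every vertex of `S` has at most one
neighbor outside `S`; for every `v ∈ S` with a neighbor outside `S`, placing that
neighbor anywhere on the open ray from `p v` in the positive `z`-direction and joining
it to `p v` by a straight segment stays disjoint from the rest of the drawing
(`ray_clear`) and makes angles at least `2π/3` with the initial segments of the edges
at `v` (`ray_angle`), so that for every choice of the point the extended drawing of
`G[S ∪ {w}]` is non-crossing with angular resolution at least `2π/3` and no bends on
`vw`; and no three extension rays are coplanar. -/
structure IsVertExtensible {V : Type*} (G : SimpleGraph V) (S : Set V)
    (D : PolylineDrawing (G.induce S)) : Prop where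
  noncross : NonCrossing D
  bends : MaxBends D 2
  res : AngularResAtLeast D (2 * Real.pi / 3)
  out_unique : ∀ v : S, ∀ w w' : V, w ∉ S → w' ∉ S →
    G.Adj (v : V) w → G.Adj (v : V) w' → w = w'
  ray_clear : ∀ v : S, (∃ w, w ∉ S ∧ G.Adj (v : V) w) →
    zRay (D.p v) ∩ drawingImage D = ∅
  ray_angle : ∀ v : S, (∃ w, w ∉ S ∧ G.Adj (v : V) w) →
    ∀ u : S, ∀ h : (G.induce S).Adj v u, ∀ a : Pt, (D.seq v u h)[1]? = some a →
      2 * Real.pi / 3 ≤ angle zDir (a - D.p v)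
  rays_noncoplanar : ∀ v₁ v₂ v₃ : S,
    (∃ w, w ∉ S ∧ G.Adj (v₁ : V) w) → (∃ w, w ∉ S ∧ G.Adj (v₂ : V) w) →
    (∃ w, w ∉ S ∧ G.Adj (v₃ : V) w) →
    v₁ ≠ v₂ → v₁ ≠ v₃ → v₂ ≠ v₃ →
    ¬ Coplanar ℝ (zRay (D.p v₁) ∪ zRay (D.p v₂) ∪ zRay (D.p v₃))

/-! ### Polylines with four points -/

lemma polyImage_four (a b c d : Pt) :
    polyImage [a, b, c, d] = segment ℝ a b ∪ segment ℝ b c ∪ segment ℝ c d := by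
  simp [polyImage, Set.union_assoc]

lemma polyImage_four_reverse (a b c d : Pt) :
    polyImage [d, c, b, a] = polyImage [a, b, c, d] := by
  rw [polyImage_four, polyImage_four, segment_symm ℝ d c, segment_symm ℝ c b,
    segment_symm ℝ b a]
  ac_rfl

lemma simplePolyline_four_iff (a b c d : Pt) :
    SimplePolyline [a, b, c, d] ↔ (a ≠ b ∧ b ≠ c ∧ c ≠ d) ∧
      segment ℝ a b ∩ segment ℝ b c = {b} ∧ segment ℝ b c ∩ segment ℝ c d = {c} ∧
      segment ℝ a b ∩ segment ℝ c d = ∅ := by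
  constructor
  · rintro ⟨h, h'⟩
    refine ⟨by simpa [List.Chain'] using h, ?_, ?_, ?_⟩
    · simpa using h' 0 1 (by simp) (by simp) (by simp)
    · simpa using h' 1 2 (by simp) (by simp) (by simp)
    · simpa using h' 0 2 (by simp) (by simp) (by simp)
  · rintro ⟨h, h₁, h₂, h₃⟩
    refine ⟨by simpa [List.Chain'] using h, fun i j hi hj hij => ?_⟩
    simp only [List.length_cons, List.length_nil] at hi hj
    obtain ⟨rfl, rfl⟩ | ⟨rfl, rfl⟩ | ⟨rfl, rfl⟩ :
        (i = 0 ∧ j = 1) ∨ (i = 1 ∧ j = 2) ∨ (i = 0 ∧ j = 2) := by omega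
    · simpa using h₁
    · simpa using h₂
    · simpa using h₃

lemma SimplePolyline.four_reverse {a b c d : Pt} (h : SimplePolyline [a, b, c, d]) :
    SimplePolyline [d, c, b, a] := by
  rw [simplePolyline_four_iff] at h ⊢
  obtain ⟨⟨h₁, h₂, h₃⟩, h₄, h₅, h₆⟩ := h
  rw [segment_symm ℝ d c, segment_symm ℝ c b, segment_symm ℝ b a]
  refine ⟨⟨h₃.symm, h₂.symm, h₁.symm⟩, ?_, ?_, ?_⟩ <;> rwa [Set.inter_comm]

lemma map_mem_of_mem_segment (φ : Pt →ₗ[ℝ] ℝ) {s : Set ℝ} (hs : Convex ℝ s) {a b q : Pt}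
    (ha : φ a ∈ s) (hb : φ b ∈ s) (hq : q ∈ segment ℝ a b) : φ q ∈ s :=
  (hs.linear_preimage φ).segment_subset ha hb hq

lemma eq_left_of_mem_segment (φ : Pt →ₗ[ℝ] ℝ) {a b q : Pt} (hab : φ a < φ b)
    (hq : q ∈ segment ℝ a b) (hqa : φ q ≤ φ a) : q = a := by
  rw [segment_eq_image'] at hq
  obtain ⟨s, ⟨hs, -⟩, rfl⟩ := hq
  simp only [map_add, map_smul, map_sub, smul_eq_mul] at hqa
  have : s = 0 := by nlinarith
  simp [this]

/-- A four-point polyline is simple if a linear functional increases strictly along its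
first two segments and is constant on its last one. -/
lemma simplePolyline_of_map_lt (φ : Pt →ₗ[ℝ] ℝ) {a b c d : Pt} (hab : φ a < φ b)
    (hbc : φ b < φ c) (hcd : φ c = φ d) (hne : c ≠ d) : SimplePolyline [a, b, c, d] := by
  rw [simplePolyline_four_iff]
  refine ⟨⟨?_, ?_, hne⟩, ?_, ?_, ?_⟩
  · rintro rfl; exact hab.false
  · rintro rfl; exact hbc.false
  · refine Set.Subset.antisymm (fun x hx => ?_) ?_
    · exact eq_left_of_mem_segment φ hbc hx.2
        (map_mem_of_mem_segment φ (convex_Iic (φ b)) hab.le Set.self_mem_Iic hx.1)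
    · rintro x rfl
      exact ⟨right_mem_segment ℝ _ _, left_mem_segment ℝ _ _⟩
  · refine Set.Subset.antisymm (fun x hx => ?_) ?_
    · refine eq_left_of_mem_segment (-φ) (by simpa using hbc) (segment_symm ℝ b c ▸ hx.1) ?_
      have := map_mem_of_mem_segment φ (convex_Ici (φ c)) Set.self_mem_Ici hcd.le hx.2
      simpa using this
    · rintro x rfl
      exact ⟨right_mem_segment ℝ _ _, left_mem_segment ℝ _ _⟩
  · refine Set.eq_empty_of_forall_notMem fun x hx => ?_
    have h₁ := map_mem_of_mem_segment φ (convex_Iic (φ b)) hab.le Set.self_mem_Iic hx.1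
    have h₂ := map_mem_of_mem_segment φ (convex_Ici (φ c)) Set.self_mem_Ici hcd.le hx.2
    exact absurd (h₂.trans h₁) (not_le.2 hbc)

/-- Two four-point polylines issuing from a common point and otherwise separated by a level
plane of a linear functional through that point meet only there. -/
lemma polyImage_inter_eq_singleton (φ : Pt →ₗ[ℝ] ℝ) {o a b c a' b' c' : Pt}
    (ha : φ o < φ a) (hb : φ o < φ b) (hc : φ o < φ c)
    (ha' : φ a' ≤ φ o) (hb' : φ b' ≤ φ o) (hc' : φ c' ≤ φ o) :
    polyImage [o, a, b, c] ∩ polyImage [o, a', b', c'] = {o} := by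
  rw [polyImage_four, polyImage_four]
  refine Set.Subset.antisymm ?_ ?_
  · rintro x ⟨hx, hx'⟩
    have hle : φ x ≤ φ o := by
      rcases hx' with (hx' | hx') | hx'
      · exact map_mem_of_mem_segment φ (convex_Iic (φ o)) Set.self_mem_Iic ha' hx'
      · exact map_mem_of_mem_segment φ (convex_Iic (φ o)) ha' hb' hx'
      · exact map_mem_of_mem_segment φ (convex_Iic (φ o)) hb' hc' hx'
    rcases hx with (hx | hx) | hx
    · exact eq_left_of_mem_segment φ ha hx hle
    · exact absurd (map_mem_of_mem_segment φ (convex_Ioi (φ o)) ha hb hx) (not_lt.2 hle)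
    · exact absurd (map_mem_of_mem_segment φ (convex_Ioi (φ o)) hb hc hx) (not_lt.2 hle)
  · rintro x rfl
    exact ⟨.inl (.inl (left_mem_segment ℝ _ _)), .inl (.inl (left_mem_segment ℝ _ _))⟩

/-! ### Vertical rays -/

lemma mem_zRay_or_eq_of_mem_segment {q w x : Pt} (hq : q ∈ zRay w) (hx : x ∈ segment ℝ q w) :
    x ∈ zRay w ∨ x = w := by
  obtain ⟨t, ht, rfl⟩ := hq
  rw [segment_symm, segment_eq_image'] at hx
  obtain ⟨s, ⟨hs, -⟩, rfl⟩ := hx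
  rcases hs.eq_or_lt with rfl | hs
  · right; simp
  · left
    exact ⟨s * t, mul_pos hs ht, by simp [mul_smul]⟩

lemma zRay_inter_zRay {q w x : Pt} (hq : x ∈ zRay q) (hw : x ∈ zRay w) :
    q = w ∨ q ∈ zRay w ∨ w ∈ zRay q := by
  obtain ⟨s, hs, rfl⟩ := hq
  obtain ⟨t, ht, h⟩ := hw
  have hqw : q = w + (t - s) • zDir := by
    rw [sub_smul, ← add_sub_assoc, ← h, add_sub_cancel_right]
  rcases lt_trichotomy s t with hst | rfl | hst
  · exact .inr (.inl ⟨t - s, sub_pos.2 hst, hqw⟩)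
  · left; simpa using hqw
  · refine .inr (.inr ⟨s - t, sub_pos.2 hst, ?_⟩)
    rw [hqw, add_assoc, ← add_smul]; simp

lemma coplanar_zRays {a b c : Pt} (l τ : ℝ) (h : c = a + l • (b - a) + τ • zDir) :
    Coplanar ℝ (zRay a ∪ zRay b ∪ zRay c) := by
  classical
  set W : Submodule ℝ Pt := Submodule.span ℝ (({b - a, zDir} : Finset Pt) : Set Pt)
  have hb : b - a ∈ W := Submodule.subset_span (by simp)
  have hz : zDir ∈ W := Submodule.subset_span (by simp)
  have hcop : Coplanar ℝ (AffineSubspace.mk' a W : Set Pt) := by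
    rw [coplanar_iff_finrank_le_two, ← AffineSubspace.direction_eq_vectorSpan,
      AffineSubspace.direction_mk']
    exact (finrank_span_finset_le_card _).trans Finset.card_le_two
  refine hcop.subset ?_
  rintro x ((⟨t, -, rfl⟩ | ⟨t, -, rfl⟩) | ⟨t, -, rfl⟩) <;>
    simp only [SetLike.mem_coe, AffineSubspace.mem_mk', vsub_eq_sub]
  · simpa using W.smul_mem t hz
  · have : b + t • zDir - a = (b - a) + t • zDir := by abel
    rw [this]
    exact W.add_mem hb (W.smul_mem t hz)
  · have : c + t • zDir - a = l • (b - a) + τ • zDir + t • zDir := by rw [h]; abel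
    rw [this]
    exact W.add_mem (W.add_mem (W.smul_mem l hb) (W.smul_mem τ hz)) (W.smul_mem t hz)

/-! ### Angles -/

lemma two_pi_div_three_le_angle {u w : Pt} (h0 : inner ℝ u w < 0)
    (h : inner ℝ u u * inner ℝ w w ≤ 4 * (inner ℝ u w) ^ 2) :
    2 * Real.pi / 3 ≤ angle u w := by
  have hu : 0 < ‖u‖ := norm_pos_iff.2 (by rintro rfl; simp at h0)
  have hw : 0 < ‖w‖ := norm_pos_iff.2 (by rintro rfl; simp at h0)
  have hcos : Real.arccos (-(1 / 2)) = 2 * Real.pi / 3 := by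
    rw [Real.arccos_neg, ← Real.cos_pi_div_three, Real.arccos_cos] <;>
      linarith [Real.pi_pos]
  rw [← hcos, angle]
  refine Real.arccos_le_arccos ?_
  rw [div_le_iff₀ (mul_pos hu hw)]
  rw [real_inner_self_eq_norm_sq, real_inner_self_eq_norm_sq] at h
  have : (‖u‖ * ‖w‖) ≤ 2 * -inner ℝ u w := by
    refine abs_le_of_sq_le_sq' (by nlinarith) (by linarith) |>.2
  linarith

/-! ### Adding one vertex to a drawing -/

open Classical in
/-- Add the vertex `v` to a drawing of `G[S]`, placed at `o`; its edge to `w ∈ S` has the two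
bends `P w` and `Q w`. -/
def PolylineDrawing.addVertex {S : Set V} (D : PolylineDrawing (G.induce S)) (v : V)
    (o : Pt) (P Q : S → Pt) (ho : o ∉ Set.range D.p) :
    PolylineDrawing (G.induce (insert v S)) where
  p x := if h : x.1 ∈ S then D.p ⟨x, h⟩ else o
  p_inj := by
    rintro ⟨x, hx⟩ ⟨y, hy⟩ h
    by_cases hxS : x ∈ S <;> by_cases hyS : y ∈ S <;>
      simp only [hxS, hyS, dite_true, dite_false] at h
    · simpa using D.p_inj h
    · exact absurd ⟨_, h⟩ ho
    · exact absurd ⟨_, h.symm⟩ ho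
    · simp [hx.resolve_right hxS, hy.resolve_right hyS]
  seq x y h :=
    if hx : x.1 ∈ S then
      if hy : y.1 ∈ S then D.seq ⟨x, hx⟩ ⟨y, hy⟩ h
      else [D.p ⟨x, hx⟩, Q ⟨x, hx⟩, P ⟨x, hx⟩, o]
    else
      if hy : y.1 ∈ S then [o, P ⟨y, hy⟩, Q ⟨y, hy⟩, D.p ⟨y, hy⟩]
      else [o]
  seq_head := by
    rintro ⟨x, hx⟩ ⟨y, hy⟩ h
    by_cases hxS : x ∈ S <;> by_cases hyS : y ∈ S <;> simp [hxS, hyS]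
    exact D.seq_head _ _ _
  seq_last := by
    rintro ⟨x, hx⟩ ⟨y, hy⟩ h
    by_cases hxS : x ∈ S <;> by_cases hyS : y ∈ S <;> simp [hxS, hyS]
    exact D.seq_last _ _ _
  seq_symm := by
    rintro ⟨x, hx⟩ ⟨y, hy⟩ h
    by_cases hxS : x ∈ S <;> by_cases hyS : y ∈ S <;> simp only [hxS, hyS, dite_true, dite_false]
    · exact D.seq_symm _ _ _
    all_goals simp

/-- The vertex `w` of `S`, regarded as a vertex of `insert v S`. -/
abbrev oldVertex {S : Set V} (v : V) (w : S) : ↥(insert v S) := ⟨w, Or.inr w.2⟩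

/-- The vertex `v`, regarded as a vertex of `insert v S`. -/
abbrev newVertex (S : Set V) (v : V) : ↥(insert v S) := ⟨v, Or.inl rfl⟩

lemma eq_newVertex_or_oldVertex {S : Set V} {v : V} (x : ↥(insert v S)) :
    x = newVertex S v ∨ ∃ w, x = oldVertex v w := by
  obtain ⟨x, rfl | hx⟩ := x
  · exact .inl rfl
  · exact .inr ⟨⟨x, hx⟩, rfl⟩

lemma oldVertex_injective {S : Set V} (v : V) :
    Function.Injective (oldVertex v : S → ↥(insert v S)) := fun a b h => by
  simpa [Subtype.ext_iff] using h

lemma oldVertex_ne_newVertex {S : Set V} {v : V} (hv : v ∉ S) (w : S) :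
    oldVertex v w ≠ newVertex S v := fun h => by
  obtain rfl : (w : V) = v := congrArg Subtype.val h
  exact hv w.2

/-- The edge from `o` to the vertex `w`, with bends `P` and `Q`, can be added to `D` in such a
way that its last segment lies on the extension ray of `w`, and no other extension ray is hit. -/
structure IsArm {S : Set V} (D : PolylineDrawing (G.induce S)) (v : V) (o : Pt) (w : S)
    (P Q : Pt) : Prop where
  on_ray : Q ∈ zRay (D.p w)
  angle_left : 2 * Real.pi / 3 ≤ angle (o - P) (Q - P)
  angle_right : 2 * Real.pi / 3 ≤ angle (P - Q) (-zDir)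
  simple : SimplePolyline [o, P, Q, D.p w]
  clear : ∀ x ∈ segment ℝ o P ∪ segment ℝ P Q, x ∉ drawingImage D
  ray_clear : ∀ u : S, ¬ G.Adj u v → (∃ w, w ∉ S ∧ G.Adj u w) →
    ∀ x ∈ segment ℝ o P ∪ segment ℝ P Q, x ∉ zRay (D.p u)

/-- The polylines `[o, P, Q, w]` and `[o, P', Q', w']` meet only in `o`, where they form an angle
of at least `2π/3`. -/
def ArmsSeparated (o w P Q w' P' Q' : Pt) : Prop :=
  2 * Real.pi / 3 ≤ angle (P - o) (P' - o) ∧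
    polyImage [o, P, Q, w] ∩ polyImage [o, P', Q', w'] = {o}

lemma ArmsSeparated.symm {o w P Q w' P' Q' : Pt} (h : ArmsSeparated o w P Q w' P' Q') :
    ArmsSeparated o w' P' Q' w P Q :=
  ⟨by rw [angle_comm]; exact h.1, by rw [Set.inter_comm]; exact h.2⟩

lemma range_subset_drawingImage (D : PolylineDrawing G) : Set.range D.p ⊆ drawingImage D :=
  Set.subset_union_left

lemma polyImage_subset_drawingImage (D : PolylineDrawing G) {u v : V} (h : G.Adj u v) :
    polyImage (D.seq u v h) ⊆ drawingImage D := fun _ hx =>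
  .inr (Set.mem_iUnion.2 ⟨u, Set.mem_iUnion.2 ⟨v, Set.mem_iUnion.2 ⟨h, hx⟩⟩⟩)

section AddVertex

variable {S : Set V} (D : PolylineDrawing (G.induce S)) {v : V} (o : Pt) (P Q : S → Pt)
  (ho : o ∉ Set.range D.p)

lemma addVertex_p_old (w : S) : (D.addVertex v o P Q ho).p (oldVertex v w) = D.p w := by
  simp [PolylineDrawing.addVertex]

lemma addVertex_seq_old_old (u w : S)
    (h : (G.induce (insert v S)).Adj (oldVertex v u) (oldVertex v w)) :
    (D.addVertex v o P Q ho).seq _ _ h = D.seq u w h := by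
  simp [PolylineDrawing.addVertex]

lemma addVertex_p_new (hv : v ∉ S) : (D.addVertex v o P Q ho).p (newVertex S v) = o := by
  simp [PolylineDrawing.addVertex, hv]

lemma addVertex_seq_new_old (hv : v ∉ S) (w : S)
    (h : (G.induce (insert v S)).Adj (newVertex S v) (oldVertex v w)) :
    (D.addVertex v o P Q ho).seq _ _ h = [o, P w, Q w, D.p w] := by
  simp [PolylineDrawing.addVertex, hv]

lemma addVertex_seq_old_new (hv : v ∉ S) (w : S)
    (h : (G.induce (insert v S)).Adj (oldVertex v w) (newVertex S v)) :
    (D.addVertex v o P Q ho).seq _ _ h = [D.p w, Q w, P w, o] := by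
  simp [PolylineDrawing.addVertex, hv]

lemma range_addVertex_p (hv : v ∉ S) :
    Set.range (D.addVertex v o P Q ho).p = insert o (Set.range D.p) := by
  ext x
  constructor
  · rintro ⟨y, rfl⟩
    obtain rfl | ⟨w, rfl⟩ := eq_newVertex_or_oldVertex y
    · rw [addVertex_p_new D o P Q ho hv]; exact .inl rfl
    · rw [addVertex_p_old]; exact .inr ⟨w, rfl⟩
  · rintro (rfl | ⟨w, rfl⟩)
    · exact ⟨_, addVertex_p_new D _ P Q ho hv⟩
    · exact ⟨_, addVertex_p_old D o P Q ho w⟩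

end AddVertex

lemma List.eq_of_triple_infix_four {α : Type*} {a q b x y z w : α}
    (h : [a, q, b] <:+: [x, y, z, w]) :
    (a = x ∧ q = y ∧ b = z) ∨ (a = y ∧ q = z ∧ b = w) := by
  obtain ⟨s, t, h⟩ := h
  rcases s with _ | ⟨_, _ | ⟨_, s⟩⟩
  · simp at h; tauto
  · simp at h; tauto
  · have := congrArg List.length h
    simp at this
    omega

lemma IsArm.mem_cases {S : Set V} {D : PolylineDrawing (G.induce S)} {v : V} {o : Pt} {w : S}
    {P Q : Pt} (h : IsArm D v o w P Q) {x : Pt} (hx : x ∈ polyImage [o, P, Q, D.p w]) :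
    x ∈ segment ℝ o P ∪ segment ℝ P Q ∨ x ∈ zRay (D.p w) ∨ x = D.p w := by
  rw [polyImage_four] at hx
  exact hx.imp_right (mem_zRay_or_eq_of_mem_segment h.on_ray)

section AddVertex

variable {S : Set V} {D : PolylineDrawing (G.induce S)} {v : V} {o : Pt} {P Q : S → Pt}

lemma addVertex_edge_cases (hv : v ∉ S) (ho : o ∉ Set.range D.p) (x y : ↥(insert v S))
    (h : (G.induce (insert v S)).Adj x y) :
    (∃ u w, ∃ h' : (G.induce S).Adj u w, x = oldVertex v u ∧ y = oldVertex v w ∧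
      (D.addVertex v o P Q ho).seq x y h = D.seq u w h') ∨
    (∃ w : S, G.Adj v w ∧
      ((x = newVertex S v ∧ y = oldVertex v w ∧
        (D.addVertex v o P Q ho).seq x y h = [o, P w, Q w, D.p w]) ∨
      (x = oldVertex v w ∧ y = newVertex S v ∧
        (D.addVertex v o P Q ho).seq x y h = [D.p w, Q w, P w, o]))) := by
  obtain rfl | ⟨u, rfl⟩ := eq_newVertex_or_oldVertex x <;>
    obtain rfl | ⟨w, rfl⟩ := eq_newVertex_or_oldVertex y
  · exact absurd h (SimpleGraph.irrefl _)
  · exact .inr ⟨w, h, .inl ⟨rfl, rfl, addVertex_seq_new_old D o P Q ho hv w h⟩⟩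
  · exact .inr ⟨u, SimpleGraph.Adj.symm h, .inr ⟨rfl, rfl, addVertex_seq_old_new D o P Q ho hv u h⟩⟩
  · exact .inl ⟨u, w, h, rfl, rfl, addVertex_seq_old_old D o P Q ho u w h⟩

lemma addVertex_polyImage_cases (hv : v ∉ S) (ho : o ∉ Set.range D.p) (x y : ↥(insert v S))
    (h : (G.induce (insert v S)).Adj x y) :
    (∃ u w, ∃ h' : (G.induce S).Adj u w, s(x, y) = s(oldVertex v u, oldVertex v w) ∧
      ({x, y} : Set _) = {oldVertex v u, oldVertex v w} ∧
      polyImage ((D.addVertex v o P Q ho).seq x y h) = polyImage (D.seq u w h')) ∨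
    (∃ w : S, G.Adj v w ∧ s(x, y) = s(newVertex S v, oldVertex v w) ∧
      ({x, y} : Set _) = {newVertex S v, oldVertex v w} ∧
      polyImage ((D.addVertex v o P Q ho).seq x y h) = polyImage [o, P w, Q w, D.p w]) := by
  obtain ⟨u, w, h', rfl, rfl, hs⟩ | ⟨w, hw, ⟨rfl, rfl, hs⟩ | ⟨rfl, rfl, hs⟩⟩ :=
    addVertex_edge_cases (P := P) (Q := Q) hv ho x y h
  · exact .inl ⟨u, w, h', rfl, rfl, by rw [hs]⟩
  · exact .inr ⟨w, hw, rfl, rfl, by rw [hs]⟩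
  · exact .inr ⟨w, hw, Sym2.eq_swap, Set.pair_comm _ _, by rw [hs, polyImage_four_reverse]⟩

/-- An arm meets the old drawing only in its end vertex. -/
lemma IsArm.inter_drawingImage_subset {w : S} {P Q : Pt} (h : IsArm D v o w P Q)
    (hray : zRay (D.p w) ∩ drawingImage D = ∅) :
    polyImage [o, P, Q, D.p w] ∩ drawingImage D ⊆ {D.p w} := by
  rintro x ⟨hx, hxD⟩
  rcases h.mem_cases hx with hx | hx | hx
  · exact absurd hxD (h.clear x hx)
  · exact absurd (show x ∈ zRay (D.p w) ∩ drawingImage D from ⟨hx, hxD⟩) (by simp [hray])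
  · exact hx

lemma start_mem_polyImage (a b c d : Pt) : a ∈ polyImage [a, b, c, d] := by
  rw [polyImage_four]; exact .inl (.inl (left_mem_segment ℝ _ _))

lemma end_mem_polyImage (a b c d : Pt) : d ∈ polyImage [a, b, c, d] := by
  rw [polyImage_four]; exact .inr (right_mem_segment ℝ _ _)

theorem nonCrossing_addVertex (hv : v ∉ S) (hD : NonCrossing D)
    (hray : ∀ w : S, G.Adj v w → zRay (D.p w) ∩ drawingImage D = ∅)
    (harm : ∀ w : S, G.Adj v w → IsArm D v o w (P w) (Q w))
    (hsep : ∀ w w' : S, G.Adj v w → G.Adj v w' → w ≠ w' →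
      ArmsSeparated o (D.p w) (P w) (Q w) (D.p w') (P w') (Q w'))
    (ho : o ∉ Set.range D.p) (hoD : o ∉ drawingImage D) :
    NonCrossing (D.addVertex v o P Q ho) := by
  obtain ⟨hD₁, hD₂, hD₃⟩ := hD
  have hpold := addVertex_p_old D (v := v) o P Q ho
  have hpnew := addVertex_p_new D o P Q ho hv
  have hcross : ∀ u w h (z : S), G.Adj v z →
      polyImage (D.seq u w h) ∩ polyImage [o, P z, Q z, D.p z] =
        (D.addVertex v o P Q ho).p ''
          ({oldVertex v u, oldVertex v w} ∩ {newVertex S v, oldVertex v z}) := by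
    intro u w h z hz
    refine Set.Subset.antisymm ?_ ?_
    · rintro x ⟨hx, hx'⟩
      obtain rfl := (harm z hz).inter_drawingImage_subset (hray z hz)
        ⟨hx', polyImage_subset_drawingImage D h hx⟩
      have hmem : D.p z ∈ ({D.p u, D.p w} : Set Pt) := by
        rw [← hD₂ u w h]; exact ⟨hx, z, rfl⟩
      refine ⟨oldVertex v z, ⟨?_, .inr rfl⟩, hpold z⟩
      rcases hmem with hmem | hmem
      · exact .inl (congrArg _ (D.p_inj hmem))
      · exact .inr (congrArg _ (D.p_inj hmem))
    · rintro _ ⟨x, ⟨hx, hx'⟩, rfl⟩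
      have hxz : x = oldVertex v z := by
        refine hx'.resolve_left ?_
        rintro rfl
        rcases hx with hx | hx <;> exact oldVertex_ne_newVertex hv _ hx.symm
      subst hxz
      rw [hpold]
      refine ⟨?_, end_mem_polyImage _ _ _ _⟩
      have : D.p z ∈ ({D.p u, D.p w} : Set Pt) := by
        rcases hx with hx | hx
        · exact .inl (congrArg _ (oldVertex_injective v hx))
        · exact .inr (congrArg _ (oldVertex_injective v hx))
      rw [← hD₂ u w h] at this
      exact this.1
  refine ⟨fun x y h => ?_, fun x y h => ?_, fun x y x' y' h h' hne => ?_⟩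
  · obtain ⟨u, w, h', -, -, hs⟩ | ⟨w, hw, ⟨-, -, hs⟩ | ⟨-, -, hs⟩⟩ :=
      addVertex_edge_cases (P := P) (Q := Q) hv ho x y h <;> rw [hs]
    · exact hD₁ _ _ _
    · exact (harm w hw).simple
    · exact (harm w hw).simple.four_reverse
  · rw [range_addVertex_p D o P Q ho hv, ← Set.image_pair]
    obtain ⟨u, w, h', -, hs, hi⟩ | ⟨w, hw, -, hs, hi⟩ :=
      addVertex_polyImage_cases (P := P) (Q := Q) hv ho x y h <;>
        rw [hs, hi, Set.image_pair]
    · rw [hpold, hpold, ← hD₂ u w h', Set.inter_insert_of_notMem]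
      exact fun h'' => hoD (polyImage_subset_drawingImage D h' h'')
    · rw [hpold, hpnew, Set.inter_insert_of_mem (start_mem_polyImage _ _ _ _)]
      congr 1
      refine Set.Subset.antisymm ?_ ?_
      · exact (Set.inter_subset_inter_right _ (range_subset_drawingImage D)).trans
          ((harm w hw).inter_drawingImage_subset (hray w hw))
      · rintro _ rfl
        exact ⟨end_mem_polyImage _ _ _ _, w, rfl⟩
  · obtain ⟨u, w, k, he, hs, hi⟩ | ⟨w, hw, he, hs, hi⟩ :=
      addVertex_polyImage_cases (P := P) (Q := Q) hv ho x y h <;>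
    obtain ⟨u', w', k', he', hs', hi'⟩ | ⟨w', hw', he', hs', hi'⟩ :=
      addVertex_polyImage_cases (P := P) (Q := Q) hv ho x' y' h' <;>
    rw [hs, hi, hs', hi'] <;> rw [he, he'] at hne
    · rw [hD₃ u w u' w' k k', ← Set.image_pair, ← Set.image_pair,
        ← Set.image_inter (oldVertex_injective v), Set.image_image]
      · simp only [hpold]
      · intro heq
        refine hne ?_
        simpa using congrArg (Sym2.map (oldVertex v)) heq
    · exact hcross u w k w' hw'
    · rw [Set.inter_comm, hcross u' w' k' w hw, Set.inter_comm]
    · have hww : w ≠ w' := by rintro rfl; exact hne rfl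
      rw [(hsep w w' hw hw' hww).2, ← Set.insert_inter_distrib,
        Set.singleton_inter_eq_empty.2, insert_empty_eq, Set.image_singleton, hpnew]
      exact fun hmem => hww (oldVertex_injective v hmem)

theorem angularResAtLeast_addVertex (hv : v ∉ S) (hD : AngularResAtLeast D (2 * Real.pi / 3))
    (hray : ∀ w : S, G.Adj v w → ∀ u : S, ∀ h : (G.induce S).Adj w u, ∀ a : Pt,
      (D.seq w u h)[1]? = some a → 2 * Real.pi / 3 ≤ angle zDir (a - D.p w))
    (harm : ∀ w : S, G.Adj v w → IsArm D v o w (P w) (Q w))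
    (hsep : ∀ w w' : S, G.Adj v w → G.Adj v w' → w ≠ w' →
      ArmsSeparated o (D.p w) (P w) (Q w) (D.p w') (P w') (Q w'))
    (ho : o ∉ Set.range D.p) :
    AngularResAtLeast (D.addVertex v o P Q ho) (2 * Real.pi / 3) := by
  have hpold := addVertex_p_old D (v := v) o P Q ho
  have hpnew := addVertex_p_new D o P Q ho hv
  have hQ : ∀ w : S, G.Adj v w → ∀ x, angle (Q w - D.p w) x = angle zDir x := by
    intro w hw x
    obtain ⟨t, ht, hQ⟩ := (harm w hw).on_ray
    rw [hQ, add_sub_cancel_left, angle_smul_left_of_pos _ _ ht]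
  have hQ' : ∀ w : S, G.Adj v w →
      2 * Real.pi / 3 ≤ angle (P w - Q w) (D.p w - Q w) := by
    intro w hw
    obtain ⟨t, ht, hQ⟩ := (harm w hw).on_ray
    have h₁ : D.p w - Q w = t • (-zDir) := by rw [hQ]; simp
    rw [h₁, angle_smul_right_of_pos _ _ ht]
    exact (harm w hw).angle_right
  refine ⟨fun x y h a q b hab => ?_, fun x y z hy hz hyz a b ha hb => ?_⟩
  · obtain ⟨u, w, h', -, -, hs⟩ | ⟨w, hw, ⟨-, -, hs⟩ | ⟨-, -, hs⟩⟩ :=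
      addVertex_edge_cases (P := P) (Q := Q) hv ho x y h <;> rw [hs] at hab
    · exact hD.1 _ _ _ _ _ _ hab
    · obtain ⟨rfl, rfl, rfl⟩ | ⟨rfl, rfl, rfl⟩ := List.eq_of_triple_infix_four hab
      · exact (harm w hw).angle_left
      · exact hQ' w hw
    · obtain ⟨rfl, rfl, rfl⟩ | ⟨rfl, rfl, rfl⟩ := List.eq_of_triple_infix_four hab
      · rw [angle_comm]; exact hQ' w hw
      · rw [angle_comm]; exact (harm w hw).angle_left
  · obtain ⟨u, w, k, rfl, rfl, hs⟩ | ⟨w, hw, ⟨rfl, rfl, hs⟩ | ⟨rfl, rfl, hs⟩⟩ :=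
      addVertex_edge_cases (P := P) (Q := Q) hv ho x y hy <;>
    obtain ⟨u', w', k', hx', rfl, hs'⟩ | ⟨w', hw', ⟨hx', rfl, hs'⟩ | ⟨hx', rfl, hs'⟩⟩ :=
      addVertex_edge_cases (P := P) (Q := Q) hv ho _ z hz <;>
    rw [hs] at ha <;> rw [hs'] at hb
    · obtain rfl := oldVertex_injective v hx'
      rw [hpold]
      exact hD.2 _ _ _ k k' (fun h => hyz (congrArg _ h)) _ _ ha hb
    · exact absurd hx' (oldVertex_ne_newVertex hv u)
    · obtain rfl := oldVertex_injective v hx'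
      obtain rfl : Q u = b := by simpa using hb
      rw [hpold, angle_comm, hQ u hw']
      exact hray u hw' w k a ha
    · exact absurd hx'.symm (oldVertex_ne_newVertex hv u')
    · obtain rfl : P w = a := by simpa using ha
      obtain rfl : P w' = b := by simpa using hb
      rw [hpnew]
      exact (hsep w w' hw hw' (fun h => hyz (congrArg _ h))).1
    · exact absurd hx'.symm (oldVertex_ne_newVertex hv w')
    · obtain rfl := oldVertex_injective v hx'
      obtain rfl : Q w = a := by simpa using ha
      rw [hpold, hQ w hw]
      exact hray w hw w' k' b hb
    · exact absurd hx' (oldVertex_ne_newVertex hv w)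
    · exact absurd rfl hyz

theorem IsVertExtensible.addVertex (hD : IsVertExtensible G S D) (hv : v ∉ S)
    (hin : ∀ w, G.Adj v w → w ∈ S)
    (harm : ∀ w : S, G.Adj v w → IsArm D v o w (P w) (Q w))
    (hsep : ∀ w w' : S, G.Adj v w → G.Adj v w' → w ≠ w' →
      ArmsSeparated o (D.p w) (P w) (Q w) (D.p w') (P w') (Q w'))
    (ho : o ∉ Set.range D.p) (hoD : o ∉ drawingImage D)
    (hoR : ∀ u : S, ¬ G.Adj u v → (∃ w, w ∉ S ∧ G.Adj u w) → o ∉ zRay (D.p u)) :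
    IsVertExtensible G (insert v S) (D.addVertex v o P Q ho) := by
  have hpold := addVertex_p_old D (v := v) o P Q ho
  have hpnew := addVertex_p_new D o P Q ho hv
  have hout : ∀ w : S, G.Adj v w → ∃ w', w' ∉ S ∧ G.Adj w w' := fun w hw => ⟨v, hv, hw.symm⟩
  have hsub : ∀ {w}, w ∉ insert v S → w ∉ S := fun h h' => h (.inr h')
  have hold : ∀ x : ↥(insert v S), (∃ w, w ∉ insert v S ∧ G.Adj x w) →
      ∃ u : S, x = oldVertex v u ∧ (∃ w, w ∉ S ∧ G.Adj u w) ∧ ¬ G.Adj u v := by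
    rintro x ⟨w, hw, hxw⟩
    obtain rfl | ⟨u, rfl⟩ := eq_newVertex_or_oldVertex x
    · exact absurd (hin w hxw) (hsub hw)
    · refine ⟨u, rfl, ⟨w, hsub hw, hxw⟩, fun huv => hw (.inl ?_)⟩
      exact hD.out_unique u w v (hsub hw) hv hxw huv
  refine ⟨?_, ?_, ?_, ?_, ?_, ?_, ?_⟩
  · exact nonCrossing_addVertex hv hD.noncross (fun w hw => hD.ray_clear w (hout w hw)) harm hsep
      ho hoD
  · intro x y h
    obtain ⟨u, w, h', -, -, hs⟩ | ⟨w, hw, ⟨-, -, hs⟩ | ⟨-, -, hs⟩⟩ :=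
      addVertex_edge_cases (P := P) (Q := Q) hv ho x y h <;> rw [hs]
    · exact hD.bends _ _ _
    · simp
    · simp
  · exact angularResAtLeast_addVertex hv hD.res (fun w hw => hD.ray_angle w (hout w hw)) harm hsep
      ho
  · intro x w w' hw hw' hxw hxw'
    obtain ⟨u, rfl, -, -⟩ := hold x ⟨w, hw, hxw⟩
    exact hD.out_unique u w w' (hsub hw) (hsub hw') hxw hxw'
  · intro x hx
    obtain ⟨u, rfl, hu, huv⟩ := hold x hx
    rw [hpold]
    refine Set.eq_empty_of_forall_notMem fun q hq => ?_
    obtain ⟨hqr, hqD⟩ := hq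
    have hclear : q ∉ drawingImage D := fun h =>
      Set.eq_empty_iff_forall_notMem.1 (hD.ray_clear u hu) q ⟨hqr, h⟩
    rcases hqD with hqD | hqD
    · rw [range_addVertex_p D o P Q ho hv] at hqD
      rcases hqD with rfl | hqD
      · exact hoR u huv hu hqr
      · exact hclear (range_subset_drawingImage D hqD)
    · simp only [Set.mem_iUnion] at hqD
      obtain ⟨x, y, h, hq⟩ := hqD
      obtain ⟨u', w, h', -, -, hi⟩ | ⟨w, hw, -, -, hi⟩ :=
        addVertex_polyImage_cases (P := P) (Q := Q) hv ho x y h <;> rw [hi] at hq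
      · exact hclear (polyImage_subset_drawingImage D h' hq)
      · rcases (harm w hw).mem_cases hq with hq | hq | rfl
        · exact (harm w hw).ray_clear u huv hu q hq hqr
        · rcases zRay_inter_zRay hqr hq with h | h | h
          · exact huv (D.p_inj h ▸ hw.symm)
          · exact Set.eq_empty_iff_forall_notMem.1 (hD.ray_clear w (hout w hw)) _
              ⟨h, range_subset_drawingImage D ⟨u, rfl⟩⟩
          · exact Set.eq_empty_iff_forall_notMem.1 (hD.ray_clear u hu) _
              ⟨h, range_subset_drawingImage D ⟨w, rfl⟩⟩
        · exact hclear (range_subset_drawingImage D ⟨w, rfl⟩)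
  · intro x hx y h a ha
    obtain ⟨u, rfl, hu, huv⟩ := hold x hx
    obtain ⟨u', w, h', he, rfl, hs⟩ | ⟨w, hw, ⟨he, rfl, hs⟩ | ⟨he, rfl, hs⟩⟩ :=
      addVertex_edge_cases (P := P) (Q := Q) hv ho _ y h <;> rw [hs] at ha
    · obtain rfl := oldVertex_injective v he
      rw [hpold]
      exact hD.ray_angle u hu w h' a ha
    · exact absurd he (oldVertex_ne_newVertex hv u)
    · obtain rfl := oldVertex_injective v he
      exact absurd hw.symm huv
  · intro x y z hx hy hz hxy hxz hyz
    obtain ⟨x, rfl, hx, -⟩ := hold x hx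
    obtain ⟨y, rfl, hy, -⟩ := hold y hy
    obtain ⟨z, rfl, hz, -⟩ := hold z hz
    rw [hpold, hpold, hpold]
    exact hD.rays_noncoplanar x y z hx hy hz (fun h => hxy (congrArg _ h))
      (fun h => hxz (congrArg _ h)) (fun h => hyz (congrArg _ h))

end AddVertex

/-! ### Coordinates adapted to the vertical direction -/

/-- A similarity between `ℝ³` and `Pt` of ratio `ℓ` that fixes the vertical direction, given by
the horizontal vector `(d0, d1)` and the orientation sign `s`. -/
structure VerticalFrame where
  d0 : ℝ
  d1 : ℝ
  s : ℝ
  ℓ : ℝ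
  s_sq : s ^ 2 = 1
  ℓ_pos : 0 < ℓ
  norm_sq : d0 ^ 2 + d1 ^ 2 = ℓ ^ 2

namespace VerticalFrame

variable (F : VerticalFrame)

/-- The point with given coordinates. -/
def pt (x y z : ℝ) : Pt :=
  !₂[x * F.d0 - y * (F.s * F.d1), x * F.d1 + y * (F.s * F.d0), F.ℓ * z]

/-- The first coordinate. -/
def X : Pt →ₗ[ℝ] ℝ where
  toFun q := (F.d0 * q 0 + F.d1 * q 1) / F.ℓ ^ 2
  map_add' p q := by simp; ring
  map_smul' c q := by simp; ring

/-- The second coordinate. -/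
def Y : Pt →ₗ[ℝ] ℝ where
  toFun q := F.s * (F.d0 * q 1 - F.d1 * q 0) / F.ℓ ^ 2
  map_add' p q := by simp; ring
  map_smul' c q := by simp; ring

/-- The vertical coordinate. -/
def Z : Pt →ₗ[ℝ] ℝ where
  toFun q := q 2 / F.ℓ
  map_add' p q := by simp; ring
  map_smul' c q := by simp; ring

@[simp] lemma X_pt (x y z : ℝ) : F.X (F.pt x y z) = x := by
  have := F.ℓ_pos
  simp only [X, pt, LinearMap.coe_mk, AddHom.coe_mk, Matrix.cons_val_zero,
    Matrix.cons_val_one]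
  rw [div_eq_iff (by positivity), ← F.norm_sq]
  ring

@[simp] lemma Y_pt (x y z : ℝ) : F.Y (F.pt x y z) = y := by
  have := F.ℓ_pos
  simp only [Y, pt, LinearMap.coe_mk, AddHom.coe_mk, Matrix.cons_val_zero,
    Matrix.cons_val_one]
  rw [div_eq_iff (by positivity), ← F.norm_sq]
  linear_combination (y * (F.d0 ^ 2 + F.d1 ^ 2)) * F.s_sq

@[simp] lemma Z_pt (x y z : ℝ) : F.Z (F.pt x y z) = z := by
  have := F.ℓ_pos
  simp [Z, pt, this.ne']

lemma pt_coords (q : Pt) : F.pt (F.X q) (F.Y q) (F.Z q) = q := by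
  have := F.ℓ_pos
  ext i
  fin_cases i
  · simp only [X, Y, pt, LinearMap.coe_mk, AddHom.coe_mk, PiLp.toLp_apply, Fin.zero_eta,
      Matrix.cons_val_zero]
    field_simp
    rw [← F.norm_sq]
    linear_combination (F.d1 ^ 2 * q 0 - F.d0 * F.d1 * q 1) * F.s_sq
  · simp only [X, Y, pt, LinearMap.coe_mk, AddHom.coe_mk, PiLp.toLp_apply, Fin.mk_one,
      Matrix.cons_val_one, Matrix.cons_val_zero]
    field_simp
    rw [← F.norm_sq]
    linear_combination (F.d0 ^ 2 * q 1 - F.d0 * F.d1 * q 0) * F.s_sq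
  · simp only [Z, pt, LinearMap.coe_mk, AddHom.coe_mk, PiLp.toLp_apply, Fin.reduceFinMk,
      Matrix.cons_val]
    field_simp

lemma pt_sub_pt (x y z x' y' z' : ℝ) :
    F.pt x y z - F.pt x' y' z' = F.pt (x - x') (y - y') (z - z') := by
  ext i
  fin_cases i <;> simp [pt] <;> ring

lemma zDir_eq : zDir = F.pt 0 0 (1 / F.ℓ) := by
  have := F.ℓ_pos
  ext i
  fin_cases i <;> simp [pt, zDir, this.ne']

lemma inner_pt (x y z x' y' z' : ℝ) :
    inner ℝ (F.pt x y z) (F.pt x' y' z') = F.ℓ ^ 2 * (x * x' + y * y' + z * z') := by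
  simp only [pt, PiLp.inner_apply, Fin.sum_univ_three, Matrix.cons_val_zero,
    Matrix.cons_val_one, Matrix.cons_val, RCLike.inner_apply, conj_trivial]
  linear_combination (x * x' + y * y') * F.norm_sq +
    (y * y' * (F.d0 ^ 2 + F.d1 ^ 2)) * F.s_sq

lemma two_pi_div_three_le_angle_pt {x y z x' y' z' : ℝ} (h0 : x * x' + y * y' + z * z' < 0)
    (h : (x ^ 2 + y ^ 2 + z ^ 2) * (x' ^ 2 + y' ^ 2 + z' ^ 2) ≤
      4 * (x * x' + y * y' + z * z') ^ 2) :
    2 * Real.pi / 3 ≤ angle (F.pt x y z) (F.pt x' y' z') := by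
  have := F.ℓ_pos
  apply two_pi_div_three_le_angle
  · rw [inner_pt]
    exact mul_neg_of_pos_of_neg (by positivity) h0
  · simp only [inner_pt]
    nlinarith [mul_le_mul_of_nonneg_left h (show 0 ≤ F.ℓ ^ 4 by positivity)]

lemma two_pi_div_three_le_angle_neg_zDir {x y z : ℝ} (hz : 0 < z)
    (h : x ^ 2 + y ^ 2 ≤ 3 * z ^ 2) :
    2 * Real.pi / 3 ≤ angle (F.pt x y z) (-zDir) := by
  have hneg : -zDir = (1 / F.ℓ) • F.pt 0 0 (-1) := by
    rw [F.zDir_eq]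
    ext i
    fin_cases i <;> simp [pt]; field_simp
  rw [hneg, angle_smul_right_of_pos _ _ (one_div_pos.2 F.ℓ_pos)]
  apply F.two_pi_div_three_le_angle_pt <;> nlinarith

lemma X_zDir : F.X zDir = 0 := by rw [F.zDir_eq, X_pt]

lemma Y_zDir : F.Y zDir = 0 := by rw [F.zDir_eq, Y_pt]

lemma Z_zDir : F.Z zDir = 1 / F.ℓ := by rw [F.zDir_eq, Z_pt]

lemma mem_zRay_pt {x y z z' : ℝ} (h : z < z') : F.pt x y z' ∈ zRay (F.pt x y z) := by
  have := F.ℓ_pos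
  refine ⟨F.ℓ * (z' - z), mul_pos this (sub_pos.2 h), ?_⟩
  ext i
  fin_cases i <;> simp [pt, zDir]
  ring

lemma X_of_mem_zRay {p q : Pt} (h : p ∈ zRay q) : F.X p = F.X q := by
  obtain ⟨t, -, rfl⟩ := h
  simp [X_zDir]

lemma Y_of_mem_zRay {p q : Pt} (h : p ∈ zRay q) : F.Y p = F.Y q := by
  obtain ⟨t, -, rfl⟩ := h
  simp [Y_zDir]

lemma eq_add_smul_zDir {p q : Pt} (hX : F.X p = F.X q) (hY : F.Y p = F.Y q) :
    ∃ τ : ℝ, p = q + τ • zDir := by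
  have := F.ℓ_pos
  refine ⟨F.ℓ * (F.Z p - F.Z q), ?_⟩
  have hZ : F.Z (q + (F.ℓ * (F.Z p - F.Z q)) • zDir) = F.Z p := by
    simp only [map_add, map_smul, Z_zDir, smul_eq_mul]
    field_simp
    ring
  rw [← F.pt_coords (q + _), hZ]
  simp [X_zDir, Y_zDir, ← hX, ← hY, F.pt_coords]

/-- A frame in which `b` and `c` have the same second coordinate, `c` follows `b` at unit distance
along the first coordinate, and `a` has a larger second coordinate. -/
lemma exists_adapted {a b c : Pt} (hbc : ∀ τ : ℝ, c ≠ b + τ • zDir)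
    (ha : ∀ l τ : ℝ, a ≠ b + l • (c - b) + τ • zDir) :
    ∃ F : VerticalFrame, F.X c = F.X b + 1 ∧ F.Y c = F.Y b ∧ F.Y b < F.Y a := by
  have hpos : 0 < (c 0 - b 0) ^ 2 + (c 1 - b 1) ^ 2 := by
    by_contra! hle
    have h0 : c 0 = b 0 := by nlinarith [sq_nonneg (c 0 - b 0), sq_nonneg (c 1 - b 1)]
    have h1 : c 1 = b 1 := by nlinarith [sq_nonneg (c 0 - b 0), sq_nonneg (c 1 - b 1)]
    refine hbc (c 2 - b 2) ?_
    ext i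
    fin_cases i <;> simp [zDir, h0, h1]
  have key : ∀ s : ℝ, (hs : s ^ 2 = 1) → ∃ F : VerticalFrame, F.X c = F.X b + 1 ∧
      F.Y c = F.Y b ∧ F.Y a - F.Y b = s * (((c 0 - b 0) * (a 1 - b 1) -
        (c 1 - b 1) * (a 0 - b 0)) / ((c 0 - b 0) ^ 2 + (c 1 - b 1) ^ 2)) := by
    intro s hs
    have hsq := Real.sq_sqrt hpos.le
    refine ⟨⟨c 0 - b 0, c 1 - b 1, s, √((c 0 - b 0) ^ 2 + (c 1 - b 1) ^ 2), hs,
      Real.sqrt_pos.2 hpos, hsq.symm⟩, ?_, ?_, ?_⟩ <;>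
      simp only [X, Y, LinearMap.coe_mk, AddHom.coe_mk, hsq] <;> field_simp <;> ring
  obtain ⟨F, hX, hY, hF⟩ := key 1 (by norm_num)
  obtain ⟨F', hX', hY', hF'⟩ := key (-1) (by norm_num)
  rcases lt_trichotomy (F.Y b) (F.Y a) with h | h | h
  · exact ⟨F, hX, hY, h⟩
  · obtain ⟨τ, hτ⟩ := F.eq_add_smul_zDir (p := a) (q := b + (F.X a - F.X b) • (c - b))
      (by simp [hX]) (by simp [hY, h])
    exact absurd hτ (ha _ _)
  · exact ⟨F', hX', hY', by linarith⟩

end VerticalFrame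

lemma isCompact_polyImage (l : List Pt) : IsCompact (polyImage l) := by
  refine (List.finite_toSet (l.zip l.tail)).isCompact_biUnion fun q _ => ?_
  rw [← convexHull_pair]
  exact (Set.toFinite {q.1, q.2}).isCompact_convexHull ℝ

lemma isCompact_drawingImage [Finite V] (D : PolylineDrawing G) : IsCompact (drawingImage D) :=
  (Set.finite_range D.p).isCompact.union <| isCompact_iUnion fun _ => isCompact_iUnion fun _ =>
    isCompact_iUnion fun _ => isCompact_polyImage _

/-! ### Placing the new vertex -/

namespace VerticalFrame

variable (F : VerticalFrame) {S : Set V} {D : PolylineDrawing (G.induce S)} {v : V} {w : S}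

lemma notMem_drawingImage_of_lt_Z {K : ℝ} (hK : ∀ q ∈ drawingImage D, F.Z q < K) {o P Q : Pt}
    (ho : K < F.Z o) (hP : K < F.Z P) (hQ : K < F.Z Q) :
    ∀ x ∈ segment ℝ o P ∪ segment ℝ P Q, x ∉ drawingImage D := by
  rintro x (hx | hx) hxD
  · exact lt_asymm (hK x hxD) (map_mem_of_mem_segment F.Z (convex_Ioi K) ho hP hx)
  · exact lt_asymm (hK x hxD) (map_mem_of_mem_segment F.Z (convex_Ioi K) hP hQ hx)

lemma mem_zRay_of_lt_Z {K : ℝ} (hK : ∀ q ∈ drawingImage D, F.Z q < K) {z : ℝ} (hz : K < z) :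
    F.pt (F.X (D.p w)) (F.Y (D.p w)) z ∈ zRay (D.p w) := by
  have := F.mem_zRay_pt (x := F.X (D.p w)) (y := F.Y (D.p w))
    ((hK _ (range_subset_drawingImage D ⟨w, rfl⟩)).trans hz)
  rwa [F.pt_coords] at this

/-- An arm that leaves the new vertex in the direction `(-σ * δ, -4 * t, 3 * t)`, runs parallel to
the first axis and descends to `w`. -/
lemma isArm_side {K : ℝ} (hK : ∀ q ∈ drawingImage D, F.Z q < K) {σ δ x t ox oy h : ℝ}
    (hσ : σ ^ 2 = 1) (hδ0 : 0 < δ) (hδ : δ ^ 2 = 75 * t ^ 2) (ht : 0 < t) (hx : 0 < x)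
    (hox : ox = F.X (D.p w) + σ * (x + δ)) (hoy : oy = F.Y (D.p w) + 4 * t)
    (hh : K + x < h)
    (hu : ∀ u : S, ¬ G.Adj u v → (∃ w, w ∉ S ∧ G.Adj (u : V) w) →
      F.Y (D.p u) ∉ Set.Icc (oy - 4 * t) oy) :
    IsArm D v (F.pt ox oy h) w (F.pt (ox - σ * δ) (oy - 4 * t) (h + 3 * t))
      (F.pt (F.X (D.p w)) (F.Y (D.p w)) (h + 3 * t - 2 * x / 3)) := by
  have hwy : F.Y (D.p w) = oy - 4 * t := by linarith
  have hδt : 8.5 * t ≤ δ := by nlinarith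
  refine ⟨F.mem_zRay_of_lt_Z hK (by linarith), ?_, ?_, ?_, ?_, ?_⟩
  · rw [pt_sub_pt, pt_sub_pt]
    have e1 : F.X (D.p w) - (ox - σ * δ) = -(σ * x) := by rw [hox]; ring
    have e2 : ox - (ox - σ * δ) = σ * δ := by ring
    have e3 : σ * δ * -(σ * x) = -(δ * x) := by linear_combination (-δ * x) * hσ
    have e4 : (σ * δ) ^ 2 = 75 * t ^ 2 := by rw [mul_pow, hσ, one_mul, hδ]
    have e5 : (-(σ * x)) ^ 2 = x ^ 2 := by rw [neg_sq, mul_pow, hσ, one_mul]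
    rw [e1, e2, hwy]
    apply F.two_pi_div_three_le_angle_pt
    · rw [e3]
      nlinarith [mul_pos hx ht]
    · rw [e3, e4, e5]
      have : 38 * t ^ 2 ≤ (δ - 2 * t) ^ 2 := by nlinarith
      nlinarith [mul_le_mul_of_nonneg_left this (sq_nonneg x)]
  · rw [pt_sub_pt]
    have e1 : (ox - σ * δ - F.X (D.p w)) ^ 2 = x ^ 2 := by
      rw [hox]
      linear_combination x ^ 2 * hσ
    apply F.two_pi_div_three_le_angle_neg_zDir
    · linarith
    · rw [e1, hwy]
      nlinarith
  · refine simplePolyline_of_map_lt (-σ • F.X) ?_ ?_ ?_ fun h => ?_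
    · simp only [LinearMap.smul_apply, X_pt, smul_eq_mul]
      nlinarith
    · simp only [LinearMap.smul_apply, X_pt, smul_eq_mul, hox]
      nlinarith
    · simp
    · have h1 := hK _ (range_subset_drawingImage D ⟨w, rfl⟩)
      rw [← h, Z_pt] at h1
      linarith
  · apply F.notMem_drawingImage_of_lt_Z hK <;> rw [Z_pt] <;> linarith
  · rintro u hu1 hu2 y hy hyu
    apply hu u hu1 hu2
    rw [← F.Y_of_mem_zRay hyu]
    rcases hy with hy | hy <;> refine map_mem_of_mem_segment F.Y (convex_Icc _ _) ?_ ?_ hy <;>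
      simp only [Y_pt, Set.mem_Icc] <;> constructor <;> linarith

/-- An arm that leaves the new vertex in the direction `(0, 8 * t, -6 * t)`, turns towards a point
above `w` and descends to `w`. -/
lemma isArm_top {K : ℝ} (hK : ∀ q ∈ drawingImage D, F.Z q < K) {t ox oy h k : ℝ} (ht : 0 < t)
    (hwy : oy + 8 * t < F.Y (D.p w)) (hk0 : 0 < k)
    (hk : 4 * ((F.X (D.p w) - ox) ^ 2 + (F.Y (D.p w) - oy - 8 * t) ^ 2) ≤ k ^ 2)
    (hh : K + k + 6 * t < h)
    (hu : ∀ u : S, ¬ G.Adj u v → (∃ w, w ∉ S ∧ G.Adj (u : V) w) →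
      F.Y (D.p u) ∉ Set.Icc oy (oy + 8 * t) ∧
      (F.X (D.p u) - F.X (D.p w)) * (oy + 8 * t - F.Y (D.p w)) -
        (F.Y (D.p u) - F.Y (D.p w)) * (ox - F.X (D.p w)) ≠ 0) :
    IsArm D v (F.pt ox oy h) w (F.pt ox (oy + 8 * t) (h - 6 * t))
      (F.pt (F.X (D.p w)) (F.Y (D.p w)) (h - 6 * t - k)) := by
  refine ⟨F.mem_zRay_of_lt_Z hK (by linarith), ?_, ?_, ?_, ?_, ?_⟩
  · rw [pt_sub_pt, pt_sub_pt]
    obtain ⟨e, he⟩ : ∃ e, e = F.Y (D.p w) - oy - 8 * t := ⟨_, rfl⟩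
    have e1 : F.Y (D.p w) - (oy + 8 * t) = e := by rw [he]; ring
    have e0 : 0 < e := by linarith
    rw [← he] at hk
    rw [e1]
    have hpos := mul_pos ht e0
    have hpos' := mul_pos ht hk0
    apply F.two_pi_div_three_le_angle_pt
    · nlinarith
    · have : 25 * ((F.X (D.p w) - ox) ^ 2 + e ^ 2 + k ^ 2) ≤ (8 * e + 6 * k) ^ 2 := by
        nlinarith [mul_pos e0 hk0]
      nlinarith [mul_le_mul_of_nonneg_left this (sq_nonneg t)]
  · rw [pt_sub_pt]
    apply F.two_pi_div_three_le_angle_neg_zDir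
    · linarith
    · nlinarith
  · refine simplePolyline_of_map_lt F.Y ?_ ?_ ?_ fun h => ?_
    · simp [ht]
    · simp [hwy]
    · simp
    · have h1 := hK _ (range_subset_drawingImage D ⟨w, rfl⟩)
      rw [← h, Z_pt] at h1
      linarith
  · apply F.notMem_drawingImage_of_lt_Z hK <;> rw [Z_pt] <;> linarith
  · rintro u hu1 hu2 y (hy | hy) hyu
    · apply (hu u hu1 hu2).1
      rw [← F.Y_of_mem_zRay hyu]
      refine map_mem_of_mem_segment F.Y (convex_Icc _ _) ?_ ?_ hy <;>
      simp only [Y_pt, Set.mem_Icc] <;> constructor <;> linarith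
    · apply (hu u hu1 hu2).2
      have := map_mem_of_mem_segment
        ((oy + 8 * t - F.Y (D.p w)) • F.X - (ox - F.X (D.p w)) • F.Y)
        (convex_singleton ((oy + 8 * t - F.Y (D.p w)) * F.X (D.p w) -
          (ox - F.X (D.p w)) * F.Y (D.p w))) (by simp; ring) (by simp) hy
      simp only [LinearMap.sub_apply, LinearMap.smul_apply, smul_eq_mul, Set.mem_singleton_iff,
        F.X_of_mem_zRay hyu, F.Y_of_mem_zRay hyu] at this
      linear_combination this

lemma armsSeparated_top_side {a b : Pt} {σ δ t ox oy h z z' : ℝ} (hσ : σ ^ 2 = 1)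
    (hδ : δ ^ 2 = 75 * t ^ 2) (ht : 0 < t) (ha : oy < F.Y a) (hb : F.Y b ≤ oy) :
    ArmsSeparated (F.pt ox oy h) a (F.pt ox (oy + 8 * t) (h - 6 * t)) (F.pt (F.X a) (F.Y a) z)
      b (F.pt (ox - σ * δ) (oy - 4 * t) (h + 3 * t)) (F.pt (F.X b) (F.Y b) z') := by
  constructor
  · rw [pt_sub_pt, pt_sub_pt]
    have e : (ox - σ * δ - ox) ^ 2 = 75 * t ^ 2 := by
      rw [← hδ]
      linear_combination δ ^ 2 * hσ
    apply F.two_pi_div_three_le_angle_pt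
    · nlinarith
    · rw [e]
      apply le_of_eq
      ring
  · apply polyImage_inter_eq_singleton F.Y <;> simp only [Y_pt] <;> linarith

lemma armsSeparated_side_side {b c : Pt} {δ t ox oy h z z' : ℝ} (hδ0 : 0 < δ)
    (hδ : δ ^ 2 = 75 * t ^ 2) (hb : F.X b ≤ ox) (hc : ox < F.X c) :
    ArmsSeparated (F.pt ox oy h) c (F.pt (ox - -1 * δ) (oy - 4 * t) (h + 3 * t))
      (F.pt (F.X c) (F.Y c) z) b (F.pt (ox - 1 * δ) (oy - 4 * t) (h + 3 * t))
      (F.pt (F.X b) (F.Y b) z') := by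
  constructor
  · rw [pt_sub_pt, pt_sub_pt]
    apply F.two_pi_div_three_le_angle_pt
    · nlinarith [pow_pos hδ0 2]
    · apply le_of_eq
      linear_combination (25 * t ^ 2 - 3 * δ ^ 2) * hδ
  · apply polyImage_inter_eq_singleton F.X <;> simp only [X_pt] <;> linarith

end VerticalFrame

lemma exists_mem_Ioo_forall_sub_ne_zero {ι : Type*} [Finite ι] {A B : ι → ℝ} {d e : ℝ}
    (hd : d ≠ 0) (hAB : ∀ u, A u ≠ 0 ∨ B u ≠ 0) :
    ∃ μ ∈ Set.Ioo (0 : ℝ) 1, ∀ u, A u * d - B u * (e + μ) ≠ 0 := by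
  have hfin : (⋃ u, {μ : ℝ | A u * d - B u * (e + μ) = 0}).Finite := by
    refine Set.finite_iUnion fun u => Set.Subsingleton.finite fun μ hμ ν hν => ?_
    simp only [Set.mem_ofPred_eq] at hμ hν
    by_cases hB : B u = 0
    · have hA := (hAB u).resolve_right (not_not.2 hB)
      simp [hB, hA, hd] at hμ
    · apply mul_left_cancel₀ hB
      linear_combination hν - hμ
  obtain ⟨μ, hμ, hμu⟩ := ((Set.Ioo_infinite (zero_lt_one' ℝ)).sdiff hfin).nonempty
  exact ⟨μ, hμ, fun u h => hμu (Set.mem_iUnion.2 ⟨u, h⟩)⟩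

open Filter Topology in
lemma exists_pos_forall_lt_and_ne_zero {ι : Type*} [Finite ι] {A B Y : ι → ℝ} {d κ ε : ℝ}
    (hε : 0 < ε) (hY : ∀ u, Y u ≠ 0) (hAB : ∀ u, A u * d - B u ≠ 0) :
    ∃ t : ℝ, 0 < t ∧ κ * t < ε ∧ ∀ u, Y u ∉ Set.Icc 0 (12 * t) ∧
      A u * (d + 12 * t) - B u ≠ 0 := by
  have h1 : ∀ᶠ t : ℝ in 𝓝 0, κ * t < ε ∧ ∀ u, (0 < Y u → 12 * t < Y u) ∧
      A u * (d + 12 * t) - B u ≠ 0 := by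
    refine Eventually.and ?_ (eventually_all.2 fun u => Eventually.and ?_ ?_)
    · exact (show Continuous fun t : ℝ => κ * t by fun_prop).continuousAt.eventually_lt
        continuousAt_const (by simpa)
    · rw [eventually_imp_distrib_left]
      intro hu
      exact (show Continuous fun t : ℝ => 12 * t by fun_prop).continuousAt.eventually_lt
        continuousAt_const (by simpa)
    · exact (show Continuous fun t : ℝ => A u * (d + 12 * t) - B u by fun_prop).continuousAt
        |>.eventually_ne (by simpa using hAB u)
  obtain ⟨t, ⟨ht1, ht2⟩, ht0⟩ :=
    ((h1.filter_mono nhdsWithin_le_nhds).and (self_mem_nhdsWithin (s := Set.Ioi 0))).exists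
  refine ⟨t, ht0, ht1, fun u => ⟨fun hu => ?_, (ht2 u).2⟩⟩
  exact ((ht2 u).1 (hu.1.lt_of_ne (hY u).symm)).not_ge hu.2

lemma IsVertExtensible.ne_add_smul_add_smul_zDir {S : Set V} {D : PolylineDrawing (G.induce S)}
    (hD : IsVertExtensible G S D) {v₁ v₂ v₃ : S}
    (h₁ : ∃ w, w ∉ S ∧ G.Adj (v₁ : V) w) (h₂ : ∃ w, w ∉ S ∧ G.Adj (v₂ : V) w)
    (h₃ : ∃ w, w ∉ S ∧ G.Adj (v₃ : V) w) (h₁₂ : v₁ ≠ v₂) (h₁₃ : v₁ ≠ v₃) (h₂₃ : v₂ ≠ v₃)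
    (l τ : ℝ) : D.p v₃ ≠ D.p v₁ + l • (D.p v₂ - D.p v₁) + τ • zDir := fun h =>
  hD.rays_noncoplanar v₁ v₂ v₃ h₁ h₂ h₃ h₁₂ h₁₃ h₂₃ (coplanar_zRays l τ h)

lemma exists_forall_mem_drawingImage_lt [Finite V] (D : PolylineDrawing G) (φ : Pt →ₗ[ℝ] ℝ) :
    ∃ K : ℝ, ∀ q ∈ drawingImage D, φ q < K := by
  obtain ⟨K, hK⟩ := ((isCompact_drawingImage D).image
    (LinearMap.continuous_of_finiteDimensional φ)).bddAbove
  exact ⟨K + 1, fun q hq => (hK ⟨q, hq, rfl⟩).trans_lt (lt_add_one K)⟩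

lemma exists_fun_eq_and_eq_and_eq {α β : Type*} {a b c : α} (hab : a ≠ b) (hac : a ≠ c)
    (hbc : b ≠ c) (x y z : β) : ∃ f : α → β, f a = x ∧ f b = y ∧ f c = z := by
  classical
  exact ⟨fun w => if w = a then x else if w = b then y else z, by simp, by simp [hab.symm],
    by simp [hac.symm, hbc.symm]⟩

/-- If the three neighbors `a`, `b`, `c` of `v` lie in `S`, then `v` can be added to a vertically
extensible partial drawing of `S`. -/
lemma IsVertExtensible.exists_insert [Finite V] {S : Set V} {D : PolylineDrawing (G.induce S)}
    (hD : IsVertExtensible G S D) {v : V} (hv : v ∉ S) {a b c : S} (hab : a ≠ b) (hac : a ≠ c)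
    (hbc : b ≠ c) (hN : ∀ w, G.Adj v w ↔ w = a ∨ w = b ∨ w = c) :
    ∃ D' : PolylineDrawing (G.induce (insert v S)), IsVertExtensible G (insert v S) D' := by
  have oa : ∃ w, w ∉ S ∧ G.Adj (a : V) w := ⟨v, hv, ((hN _).2 (by simp)).symm⟩
  have ob : ∃ w, w ∉ S ∧ G.Adj (b : V) w := ⟨v, hv, ((hN _).2 (by simp)).symm⟩
  have oc : ∃ w, w ∉ S ∧ G.Adj (c : V) w := ⟨v, hv, ((hN _).2 (by simp)).symm⟩
  obtain ⟨F, hXc, hYc, hYa⟩ := VerticalFrame.exists_adapted (a := D.p a) (b := D.p b)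
    (c := D.p c)
    (fun τ h => hD.ne_add_smul_add_smul_zDir ob oa oc hab.symm hbc hac 0 τ (by simpa using h))
    (hD.ne_add_smul_add_smul_zDir ob oc oa hbc hab.symm hac.symm)
  obtain ⟨K, hK⟩ := exists_forall_mem_drawingImage_lt D F.Z
  let T := {u : S // ¬ G.Adj u v ∧ ∃ w, w ∉ S ∧ G.Adj (u : V) w}
  have hT : ∀ u : T, u.1 ≠ a ∧ u.1 ≠ b ∧ u.1 ≠ c := by
    rintro ⟨u, hu, -⟩
    rw [G.adj_comm, hN] at hu
    simpa only [not_or, ne_eq, Subtype.ext_iff] using hu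
  have hX : ∀ u : T, F.X (D.p u.1) - F.X (D.p a) ≠ 0 ∨ F.Y (D.p u.1) - F.Y (D.p a) ≠ 0 := by
    intro u
    by_contra! h
    obtain ⟨τ, hτ⟩ := F.eq_add_smul_zDir (sub_eq_zero.1 h.1) (sub_eq_zero.1 h.2)
    exact hD.ne_add_smul_add_smul_zDir oa ob u.2.2 hab (hT u).1.symm (hT u).2.1.symm 0 τ
      (by simpa using hτ)
  have hY : ∀ u : T, F.Y (D.p u.1) - F.Y (D.p b) ≠ 0 := by
    intro u h
    obtain ⟨τ, hτ⟩ := F.eq_add_smul_zDir (p := D.p u.1)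
      (q := D.p b + (F.X (D.p u.1) - F.X (D.p b)) • (D.p c - D.p b))
      (by simp [hXc]) (by simp [hYc, sub_eq_zero.1 h])
    exact hD.ne_add_smul_add_smul_zDir ob oc u.2.2 hbc (hT u).2.1.symm (hT u).2.2.symm _ τ hτ
  obtain ⟨μ, ⟨hμ0, hμ1⟩, hμ⟩ := exists_mem_Ioo_forall_sub_ne_zero
    (e := F.X (D.p b) - F.X (D.p a)) (sub_neg.2 hYa).ne hX
  obtain ⟨t, ht, htε, htu⟩ := exists_pos_forall_lt_and_ne_zero (κ := 12)
    (lt_min (sub_pos.2 hYa) (lt_min hμ0 (sub_pos.2 hμ1))) hY hμ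
  obtain ⟨ht1, ht2, ht3⟩ : 12 * t < F.Y (D.p a) - F.Y (D.p b) ∧ 12 * t < μ ∧ 12 * t < 1 - μ := by
    simpa only [lt_min_iff] using htε
  obtain ⟨δ, hδ0, hδ, hδt⟩ : ∃ δ : ℝ, 0 < δ ∧ δ ^ 2 = 75 * t ^ 2 ∧ δ < 12 * t := by
    refine ⟨√(75 * t ^ 2), by positivity, Real.sq_sqrt (by positivity), ?_⟩
    rw [Real.sqrt_lt' (by positivity)]
    nlinarith [pow_pos ht 2]
  obtain ⟨ox, hox⟩ : ∃ ox, ox = F.X (D.p b) + μ := ⟨_, rfl⟩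
  obtain ⟨oy, hoy⟩ : ∃ oy, oy = F.Y (D.p b) + 4 * t := ⟨_, rfl⟩
  obtain ⟨k, hk0, hk⟩ : ∃ k : ℝ, 0 < k ∧
      4 * ((F.X (D.p a) - ox) ^ 2 + (F.Y (D.p a) - oy - 8 * t) ^ 2) ≤ k ^ 2 := by
    refine ⟨2 * (|F.X (D.p a) - ox| + (F.Y (D.p a) - oy - 8 * t)), ?_, ?_⟩
    · have := abs_nonneg (F.X (D.p a) - ox)
      linarith
    · have := mul_nonneg (abs_nonneg (F.X (D.p a) - ox))
        (show 0 ≤ F.Y (D.p a) - oy - 8 * t by linarith)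
      nlinarith [sq_abs (F.X (D.p a) - ox)]
  obtain ⟨h, hh⟩ : ∃ h, h = K + k + 6 * t + 1 := ⟨_, rfl⟩
  have hIcc : ∀ u : S, ¬ G.Adj u v → (∃ w, w ∉ S ∧ G.Adj (u : V) w) →
      F.Y (D.p u) ∉ Set.Icc (oy - 4 * t) (oy + 8 * t) := fun u h1 h2 hu =>
    (htu ⟨u, h1, h2⟩).1 ⟨by linarith [hu.1], by linarith [hu.2]⟩
  have hside : ∀ u : S, ¬ G.Adj u v → (∃ w, w ∉ S ∧ G.Adj (u : V) w) →
      F.Y (D.p u) ∉ Set.Icc (oy - 4 * t) oy := fun u h1 h2 hu =>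
    hIcc u h1 h2 ⟨hu.1, by linarith [hu.2]⟩
  have armA := F.isArm_top (v := v) (w := a) (ox := ox) (oy := oy) (h := h) hK ht (by linarith)
    hk0 hk (by linarith) fun u h1 h2 =>
      ⟨fun hu => hIcc u h1 h2 ⟨by linarith [hu.1], hu.2⟩, by
        convert (htu ⟨u, h1, h2⟩).2 using 2
        · congr 1
          linear_combination hoy
        · congr 1
          linear_combination hox⟩
  have armB := F.isArm_side (v := v) (w := b) (ox := ox) (oy := oy) (h := h) (x := μ - δ)
    (σ := 1) hK (by norm_num) hδ0 hδ ht (by linarith) (by linarith) hoy (by linarith) hside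
  have armC := F.isArm_side (v := v) (w := c) (ox := ox) (oy := oy) (h := h) (x := 1 - μ - δ)
    (σ := -1) hK (by norm_num) hδ0 hδ ht (by linarith) (by linarith) (by linarith) (by linarith)
    hside
  have sepAB := F.armsSeparated_top_side (a := D.p a) (b := D.p b) (σ := 1) (ox := ox) (oy := oy)
    (h := h) (z := h - 6 * t - k) (z' := h + 3 * t - 2 * (μ - δ) / 3) (by norm_num) hδ ht
    (by linarith) (by linarith)
  have sepAC := F.armsSeparated_top_side (a := D.p a) (b := D.p c) (σ := -1) (ox := ox) (oy := oy)
    (h := h) (z := h - 6 * t - k) (z' := h + 3 * t - 2 * (1 - μ - δ) / 3) (by norm_num) hδ ht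
    (by linarith) (by linarith)
  have sepCB := F.armsSeparated_side_side (b := D.p b) (c := D.p c) (ox := ox) (oy := oy) (h := h)
    (z := h + 3 * t - 2 * (1 - μ - δ) / 3) (z' := h + 3 * t - 2 * (μ - δ) / 3) hδ0 hδ
    (by linarith) (by linarith)
  generalize F.pt ox oy h = o at armA armB armC sepAB sepAC sepCB
  obtain ⟨P, hPa, hPb, hPc⟩ := exists_fun_eq_and_eq_and_eq hab hac hbc
    (F.pt ox (oy + 8 * t) (h - 6 * t)) (F.pt (ox - 1 * δ) (oy - 4 * t) (h + 3 * t))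
    (F.pt (ox - -1 * δ) (oy - 4 * t) (h + 3 * t))
  obtain ⟨Q, hQa, hQb, hQc⟩ := exists_fun_eq_and_eq_and_eq hab hac hbc
    (F.pt (F.X (D.p a)) (F.Y (D.p a)) (h - 6 * t - k))
    (F.pt (F.X (D.p b)) (F.Y (D.p b)) (h + 3 * t - 2 * (μ - δ) / 3))
    (F.pt (F.X (D.p c)) (F.Y (D.p c)) (h + 3 * t - 2 * (1 - μ - δ) / 3))
  rw [← hPa, ← hQa] at armA sepAB sepAC
  rw [← hPb, ← hQb] at armB sepAB sepCB
  rw [← hPc, ← hQc] at armC sepAC sepCB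
  have hoD : o ∉ drawingImage D := armA.clear o (.inl (left_mem_segment ℝ _ _))
  have hN' : ∀ w : S, G.Adj v w → w = a ∨ w = b ∨ w = c := fun w hw => by
    simpa only [Subtype.ext_iff] using (hN w).1 hw
  refine ⟨D.addVertex v o P Q fun h => hoD (range_subset_drawingImage D h),
    hD.addVertex hv (fun w hw => ?_) (fun w hw => ?_) (fun w w' hw hw' hne => ?_) _ hoD
    fun u h1 h2 => armA.ray_clear u h1 h2 o (.inl (left_mem_segment ℝ _ _))⟩
  · rcases (hN w).1 hw with rfl | rfl | rfl <;> exact Subtype.prop _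
  · rcases hN' w hw with rfl | rfl | rfl <;> assumption
  · rcases hN' w hw with rfl | rfl | rfl <;> rcases hN' w' hw' with rfl | rfl | rfl <;>
      first | exact absurd rfl hne | assumption | exact ArmsSeparated.symm ‹_›

/-- If a vertex set `S` of a graph `G` of maximum degree at most three
admits a vertically extensible partial drawing, and `v ∉ S` has exactly three neighbors,
all of which lie in `S`, then `S ∪ {v}` admits a vertically extensible partial
drawing. -/
theorem add_triskelion_to_extensible (V : Type) [Fintype V] [DecidableEq V]
    (G : SimpleGraph V) [DecidableRel G.Adj]
    (hdeg : ∀ v, G.degree v ≤ 3) (S : Set V)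
    (hS : ∃ D : PolylineDrawing (G.induce S), IsVertExtensible G S D)
    (v : V) (hv : v ∉ S)
    (h3 : {w : V | G.Adj v w}.ncard = 3)
    (hin : ∀ w : V, G.Adj v w → w ∈ S) :
    ∃ D : PolylineDrawing (G.induce (insert v S)),
      IsVertExtensible G (insert v S) D := by
  obtain ⟨D, hD⟩ := hS
  obtain ⟨a, b, c, hab, hac, hbc, hN⟩ := Set.ncard_eq_three.1 h3
  have hN' : ∀ w, G.Adj v w ↔ w = a ∨ w = b ∨ w = c := fun w => by
    simpa using Set.ext_iff.1 hN w
  have mem : ∀ w, w = a ∨ w = b ∨ w = c → w ∈ S := fun w hw => hin w ((hN' w).2 hw)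
  exact hD.exists_insert hv (a := ⟨a, mem a (by simp)⟩) (b := ⟨b, mem b (by simp)⟩)
    (c := ⟨c, mem c (by simp)⟩) (by simpa) (by simpa) (by simpa) hN'
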